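/- Let n ∈ ℕ (n ≥ 1) and let I be a proper open subinterval of ℝ. Every function f : I → ℝ that is convex of order n on I is Wright convex of order n on I. -/

import Mathlib

open Finset

/-- The difference operator `Δ_h`. -/
noncomputable def dOp (h : ℝ) (f : ℝ → ℝ) : ℝ → ℝ := fun x => f (x + h) - f x

/-- Iterated difference operator `Δ_{h_1} ⋯ Δ_{h_k}` for a list `[h_1, …, h_k]`. -/
noncomputable def dList (l : List ℝ) (f : ℝ → ℝ) : ℝ → ℝ := l.foldr dOp f

/-- The divided difference `[x_0, …, x_m; f]`. -/
noncomputable def divDiff (m : ℕ) (x : Fin (m + 1) → ℝ) (f : ℝ → ℝ) : ℝ :=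
  ∑ i, f (x i) / ∏ j ∈ Finset.univ.erase i, (x i - x j)

/-- `I` is a proper open subinterval of the real line. -/
def ProperOpenInterval (I : Set ℝ) : Prop :=
  IsOpen I ∧ I.OrdConnected ∧ I.Nonempty ∧ I ≠ Set.univ

/-- A real number which is rational. -/
def IsRatR (x : ℝ) : Prop := ∃ q : ℚ, (q : ℝ) = x

/-- `f` is Wright convex of order `n` on `I`. -/
def WrightConvexOrder (n : ℕ) (I : Set ℝ) (f : ℝ → ℝ) : Prop :=
  ∀ l : List ℝ, l.length = n + 1 → (∀ h ∈ l, 0 < h) →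
    ∀ x : ℝ, x ∈ I → x + l.sum ∈ I → 0 ≤ dList l f x

/-- `f` is Jensen convex of order `n` on `I`. -/
def JensenConvexOrder (n : ℕ) (I : Set ℝ) (f : ℝ → ℝ) : Prop :=
  ∀ h : ℝ, 0 < h → ∀ x : ℝ, x ∈ I → x + (n + 1) * h ∈ I → 0 ≤ (dOp h)^[n + 1] f x

/-- `f` is convex of order `n` on `I`. -/
def ConvexOrder (n : ℕ) (I : Set ℝ) (f : ℝ → ℝ) : Prop :=
  ∀ x : Fin (n + 2) → ℝ, Function.Injective x → (∀ i, x i ∈ I) →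
    0 ≤ divDiff (n + 1) x f

/-- The divided difference of `f` with respect to a finite set of nodes. -/
noncomputable def finsetDivDiff (s : Finset ℝ) (f : ℝ → ℝ) : ℝ :=
  ∑ a ∈ s, f a / ∏ b ∈ s.erase a, (a - b)

theorem finsetDivDiff_singleton (a : ℝ) (f : ℝ → ℝ) : finsetDivDiff {a} f = f a := by
  simp [finsetDivDiff]

theorem finsetDivDiff_map {ι : Type*} [DecidableEq ι] (s : Finset ι) (e : ι ↪ ℝ) (f : ℝ → ℝ) :
    finsetDivDiff (s.map e) f = ∑ i ∈ s, f (e i) / ∏ j ∈ s.erase i, (e i - e j) := by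
  simp [finsetDivDiff, sum_map, ← map_erase, prod_map]

theorem divDiff_eq_finsetDivDiff {m : ℕ} (x : Fin (m + 1) ↪ ℝ) (f : ℝ → ℝ) :
    divDiff m x f = finsetDivDiff (univ.map x) f :=
  (finsetDivDiff_map univ x f).symm

theorem finsetDivDiff_dOp (s : Finset ℝ) (h : ℝ) (f : ℝ → ℝ) :
    finsetDivDiff s (dOp h f) =
      finsetDivDiff (s.map (addRightEmbedding h)) f - finsetDivDiff s f := by
  rw [finsetDivDiff_map]
  simp [finsetDivDiff, dOp, sub_div]

theorem finsetDivDiff_insert {s : Finset ℝ} {a : ℝ} (ha : a ∉ s) (f : ℝ → ℝ) :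
    finsetDivDiff (insert a s) f =
      f a / ∏ b ∈ s, (a - b) + ∑ c ∈ s, f c / ((c - a) * ∏ b ∈ s.erase c, (c - b)) := by
  rw [finsetDivDiff, sum_insert ha, erase_insert ha]
  congr 1
  refine sum_congr rfl fun c hc => ?_
  have hca : a ≠ c := fun h => ha (h ▸ hc)
  rw [erase_insert_of_ne hca, prod_insert (fun h => ha (mem_of_mem_erase h))]

/-- The recurrence for divided differences. -/
theorem finsetDivDiff_insert_sub_insert {s : Finset ℝ} {a b : ℝ} (hab : a ≠ b) (ha : a ∉ s)
    (hb : b ∉ s) (f : ℝ → ℝ) :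
    finsetDivDiff (insert a s) f - finsetDivDiff (insert b s) f =
      (a - b) * finsetDivDiff (insert a (insert b s)) f := by
  have hba : b - a ≠ 0 := sub_ne_zero.2 hab.symm
  have hab' : a - b ≠ 0 := sub_ne_zero.2 hab
  have hnot : a ∉ insert b s := by simp [hab, ha]
  rw [finsetDivDiff_insert hnot, finsetDivDiff_insert ha, finsetDivDiff_insert hb,
    prod_insert hb, sum_insert hb, erase_insert hb, mul_add, mul_add, mul_sum]
  have hsum : ∑ c ∈ s, (a - b) * (f c / ((c - a) * ∏ d ∈ (insert b s).erase c, (c - d))) =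
      ∑ c ∈ s, f c / ((c - a) * ∏ d ∈ s.erase c, (c - d)) -
        ∑ c ∈ s, f c / ((c - b) * ∏ d ∈ s.erase c, (c - d)) := by
    rw [← sum_sub_distrib]
    refine sum_congr rfl fun c hc => ?_
    have hbc : b ≠ c := fun h => hb (h ▸ hc)
    have hca : c - a ≠ 0 := sub_ne_zero.2 fun h => ha (h ▸ hc)
    have hcb : c - b ≠ 0 := sub_ne_zero.2 hbc.symm
    have hprod : ∏ d ∈ s.erase c, (c - d) ≠ 0 :=
      prod_ne_zero_iff.2 fun d hd => sub_ne_zero.2 (ne_of_mem_erase hd).symm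
    rw [erase_insert_of_ne hbc, prod_insert (fun h => hb (mem_of_mem_erase h))]
    field_simp
    ring
  have hprod_a : ∏ d ∈ s, (a - d) ≠ 0 :=
    prod_ne_zero_iff.2 fun d hd => sub_ne_zero.2 fun h => ha (h ▸ hd)
  have hprod_b : ∏ d ∈ s, (b - d) ≠ 0 :=
    prod_ne_zero_iff.2 fun d hd => sub_ne_zero.2 fun h => hb (h ▸ hd)
  have hfa : (a - b) * (f a / ((a - b) * ∏ d ∈ s, (a - d))) = f a / ∏ d ∈ s, (a - d) := by
    field_simp
  have hfb : (a - b) * (f b / ((b - a) * ∏ d ∈ s, (b - d))) = -(f b / ∏ d ∈ s, (b - d)) := by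
    field_simp
    ring
  rw [hsum, hfa, hfb]
  ring

/-- All divided differences of `f` with respect to `m + 1` distinct nodes in `J` are
nonnegative. -/
def DivDiffNonneg (m : ℕ) (J : Set ℝ) (f : ℝ → ℝ) : Prop :=
  ∀ s : Finset ℝ, s.card = m + 1 → (s : Set ℝ) ⊆ J → 0 ≤ finsetDivDiff s f

theorem ConvexOrder.divDiffNonneg {n : ℕ} {I : Set ℝ} {f : ℝ → ℝ} (hf : ConvexOrder n I f) :
    DivDiffNonneg (n + 1) I f := by
  intro s hs hsI
  have h := hf (s.orderEmbOfFin hs) (s.orderEmbOfFin hs).injective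
    fun i => hsI (s.orderEmbOfFin_mem hs i)
  have heq := divDiff_eq_finsetDivDiff (s.orderEmbOfFin hs).toEmbedding f
  rw [map_orderEmbOfFin_univ] at heq
  exact heq ▸ h

/-- Shifting the lowest nodes by `h`, starting from the largest of them, keeps all the nodes
distinct and does not decrease the divided difference. -/
theorem DivDiffNonneg.le_map_add_union {m : ℕ} {J : Set ℝ} {f : ℝ → ℝ}
    (hf : DivDiffNonneg (m + 1) J f) {h : ℝ} (hh : 0 < h) (s : Finset ℝ) :
    ∀ t : Finset ℝ, (∀ x ∈ s, ∀ y ∈ t, x + h < y) → s.card + t.card = m + 1 →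
      (∀ x ∈ s, x ∈ J ∧ x + h ∈ J) → (t : Set ℝ) ⊆ J →
      finsetDivDiff (s ∪ t) f ≤ finsetDivDiff (s.map (addRightEmbedding h) ∪ t) f := by
  induction s using Finset.induction_on_max with
  | empty => simp
  | insert a s hmax ih =>
    intro t hst hcard hsJ htJ
    have has : a ∉ s := fun h => (hmax a h).false
    have hahs : a + h ∉ s := fun h' => by linarith [hmax _ h']
    have hat : a ∉ t := fun h' => by linarith [hst a (mem_insert_self a s) a h']
    have haht : a + h ∉ t := fun h' => (hst a (mem_insert_self a s) _ h').false
    have ha : a ∉ s ∪ t := by simp [has, hat]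
    have hah : a + h ∉ s ∪ t := by simp [hahs, haht]
    have hne : a + h ≠ a := (lt_add_of_pos_right a hh).ne'
    have hdisj : Disjoint s t := disjoint_left.2 fun x hx hxt => by
      linarith [hst x (mem_insert_of_mem hx) x hxt]
    rw [card_insert_of_notMem has] at hcard
    have hnonneg : 0 ≤ finsetDivDiff (insert (a + h) (insert a (s ∪ t))) f := by
      apply hf
      · rw [card_insert_of_notMem (by simp [hh.ne', hahs, haht]), card_insert_of_notMem ha,
          card_union_of_disjoint hdisj]
        omega
      · intro x hx
        simp only [coe_insert, coe_union, Set.mem_insert_iff, Set.mem_union, mem_coe] at hx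
        rcases hx with rfl | rfl | hx | hx
        · exact (hsJ a (mem_insert_self a s)).2
        · exact (hsJ _ (mem_insert_self _ s)).1
        · exact (hsJ x (mem_insert_of_mem hx)).1
        · exact htJ hx
    have hstep : finsetDivDiff (insert a (s ∪ t)) f ≤ finsetDivDiff (insert (a + h) (s ∪ t)) f := by
      rw [← sub_nonneg, finsetDivDiff_insert_sub_insert hne hah ha]
      exact mul_nonneg (by linarith) hnonneg
    have hrest := ih (insert (a + h) t)
      (by
        intro x hx y hy
        rcases mem_insert.1 hy with rfl | hy
        · linarith [hmax x hx]
        · exact hst x (mem_insert_of_mem hx) y hy)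
      (by rw [card_insert_of_notMem haht]; omega)
      (fun x hx => hsJ x (mem_insert_of_mem hx))
      (by
        rw [coe_insert]
        exact Set.insert_subset (hsJ a (mem_insert_self a s)).2 htJ)
    rw [union_insert, union_insert] at hrest
    rw [insert_union, map_insert, insert_union]
    exact hstep.trans hrest

theorem DivDiffNonneg.dOp {m : ℕ} {J : Set ℝ} {f : ℝ → ℝ} (hf : DivDiffNonneg (m + 1) J f)
    {h : ℝ} (hh : 0 < h) : DivDiffNonneg m {x | x ∈ J ∧ x + h ∈ J} (dOp h f) := by
  intro s hs hsJ
  rw [finsetDivDiff_dOp, sub_nonneg]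
  simpa using hf.le_map_add_union hh s ∅ (by simp) (by simpa using hs) (fun x hx => hsJ hx)
    (by simp)

theorem DivDiffNonneg.dList {I : Set ℝ} (hI : I.OrdConnected) {f : ℝ → ℝ} (l : List ℝ) :
    ∀ m : ℕ, (∀ h ∈ l, 0 < h) → DivDiffNonneg (m + l.length) I f →
      DivDiffNonneg m {x | x ∈ I ∧ x + l.sum ∈ I} (dList l f) := by
  induction l with
  | nil =>
    intro m _ hf s hs hsI
    exact hf s hs fun x hx => (hsI hx).1
  | cons h l ih =>
    intro m hl hf s hs hsI
    have hh : 0 < h := hl h List.mem_cons_self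
    have hl' : ∀ k ∈ l, 0 < k := fun k hk => hl k (List.mem_cons_of_mem h hk)
    have hsum : 0 ≤ l.sum := List.sum_nonneg fun k hk => (hl' k hk).le
    rw [List.length_cons, ← add_assoc, add_right_comm] at hf
    refine (ih (m + 1) hl' hf).dOp hh s hs fun x hx => ?_
    obtain ⟨hx₀, hx₁⟩ := hsI hx
    rw [List.sum_cons] at hx₁
    exact ⟨⟨hx₀, hI.out hx₀ hx₁ ⟨by linarith, by linarith⟩⟩,
      hI.out hx₀ hx₁ ⟨by linarith, by linarith⟩, by rwa [add_assoc]⟩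

/-- Every n-convex function is n-Wright convex. -/
theorem convexOrder_implies_wrightConvexOrder (n : ℕ) (hn : 1 ≤ n) (I : Set ℝ)
    (hI : ProperOpenInterval I) (f : ℝ → ℝ) (hf : ConvexOrder n I f) :
    WrightConvexOrder n I f := by
  intro l hl hpos x hx hxl
  have h := DivDiffNonneg.dList hI.2.1 l 0 hpos (by rw [hl, zero_add]; exact hf.divDiffNonneg)
    {x} (by simp) (by simpa using ⟨hx, hxl⟩)
  rwa [finsetDivDiff_singleton] at h
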